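/- arXiv:1504.01946 — 4 statements merged into one kernel-verified Lean document; each statement's English description precedes it below -/
import Mathlib

section
/- For all real numbers n and ℓ the following identities of linear operators on ℝ[x] hold: ((n+1)·X − R∘D) ∘ ((n+ℓ)·X + R∘D) = −R∘H_{n,ℓ} + (n+1)(n+ℓ)·id and ((n+ℓ−1)·X + R∘D) ∘ (n·X − R∘D) = −R∘H_{n,ℓ} + n(n+ℓ−1)·id. Consequently on ker H_{n,ℓ} the East narrow circuit acts as the scalar (n+1)(n+ℓ) and the West narrow circuit acts as the scalar n(n+ℓ−1). -/
open Polynomial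

/-- The differentiation operator `D` on `ℝ[x]`. -/
noncomputable def Dop : Module.End ℝ (Polynomial ℝ) := derivative

/-- Multiplication by `x` on `ℝ[x]`. -/
noncomputable def Xop : Module.End ℝ (Polynomial ℝ) := LinearMap.mulLeft ℝ X

/-- The operator `R := X∘X − id`, multiplication by `x² − 1`. -/
noncomputable def Rop : Module.End ℝ (Polynomial ℝ) := Xop * Xop - 1

/-- The Legendre operator `H_{n,ℓ} := R∘D² + (ℓ+1)·X∘D − n(n+ℓ)·id`. -/
noncomputable def Hleg (n ℓ : ℝ) : Module.End ℝ (Polynomial ℝ) :=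
  Rop * Dop ^ 2 + (ℓ + 1) • (Xop * Dop) - (n * (n + ℓ)) • 1

theorem Dop_apply (p : ℝ[X]) : Dop p = derivative p := rfl

theorem Xop_apply (p : ℝ[X]) : Xop p = X * p := rfl

theorem Rop_apply (p : ℝ[X]) : Rop p = (X ^ 2 - 1) * p := by
  simp only [Rop, LinearMap.sub_apply, Module.End.mul_apply, Module.End.one_apply, Xop_apply]
  ring

theorem Hleg_apply (n ℓ : ℝ) (p : ℝ[X]) :
    Hleg n ℓ p = (X ^ 2 - 1) * derivative (derivative p)
      + (C ℓ + 1) * (X * derivative p) - C n * (C n + C ℓ) * p := by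
  simp [Hleg, pow_two, Rop_apply, Dop_apply, Xop_apply, smul_eq_C_mul]

theorem east_narrow_circuit (n ℓ : ℝ) :
    ((n + 1) • Xop - Rop * Dop) * ((n + ℓ) • Xop + Rop * Dop)
      = -(Rop * Hleg n ℓ) + ((n + 1) * (n + ℓ)) • 1 := by
  refine LinearMap.ext fun p => ?_
  simp only [LinearMap.sub_apply, LinearMap.add_apply, LinearMap.neg_apply, LinearMap.smul_apply,
    Module.End.mul_apply, Module.End.one_apply, Rop_apply, Dop_apply, Xop_apply, Hleg_apply,
    smul_eq_C_mul, derivative_add, derivative_sub, derivative_mul, derivative_C, derivative_X,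
    derivative_X_sq, derivative_one, C_add, C_mul, C_1, C_ofNat]
  ring

theorem west_narrow_circuit (n ℓ : ℝ) :
    ((n + ℓ - 1) • Xop + Rop * Dop) * (n • Xop - Rop * Dop)
      = -(Rop * Hleg n ℓ) + (n * (n + ℓ - 1)) • 1 := by
  refine LinearMap.ext fun p => ?_
  simp only [LinearMap.sub_apply, LinearMap.add_apply, LinearMap.neg_apply, LinearMap.smul_apply,
    Module.End.mul_apply, Module.End.one_apply, Rop_apply, Dop_apply, Xop_apply, Hleg_apply,
    smul_eq_C_mul, derivative_sub, derivative_mul, derivative_C, derivative_X,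
    derivative_X_sq, derivative_one, C_add, C_sub, C_mul, C_1, C_ofNat]
  ring

theorem neg_mul_add_smul_one_apply_of_mem_ker {A H : Module.End ℝ ℝ[X]} (c : ℝ) {p : ℝ[X]}
    (hp : p ∈ LinearMap.ker H) : (-(A * H) + c • 1) p = c • p := by
  simp [LinearMap.mem_ker.mp hp]

/-- The East and West narrow circuit identities of the Legendre–Gegenbauer grid and the
resulting scalar actions on `ker H_{n,ℓ}`. -/
theorem legendre_horizontal_circuits (n ℓ : ℝ) :
    (((n + 1) • Xop - Rop * Dop) * ((n + ℓ) • Xop + Rop * Dop)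
        = -(Rop * Hleg n ℓ) + ((n + 1) * (n + ℓ)) • 1)
    ∧ (((n + ℓ - 1) • Xop + Rop * Dop) * (n • Xop - Rop * Dop)
        = -(Rop * Hleg n ℓ) + (n * (n + ℓ - 1)) • 1)
    ∧ (∀ p ∈ LinearMap.ker (Hleg n ℓ),
        (((n + 1) • Xop - Rop * Dop) * ((n + ℓ) • Xop + Rop * Dop)) p
          = ((n + 1) * (n + ℓ)) • p)
    ∧ (∀ p ∈ LinearMap.ker (Hleg n ℓ),
        (((n + ℓ - 1) • Xop + Rop * Dop) * (n • Xop - Rop * Dop)) p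
          = (n * (n + ℓ - 1)) • p) := by
  refine ⟨east_narrow_circuit n ℓ, west_narrow_circuit n ℓ, fun p hp => ?_, fun p hp => ?_⟩
  · rw [east_narrow_circuit]
    exact neg_mul_add_smul_one_apply_of_mem_ker _ hp
  · rw [west_narrow_circuit]
    exact neg_mul_add_smul_one_apply_of_mem_ker _ hp
end

section
/- For all real numbers n and ℓ the following identities of linear operators on ℝ[x] hold: (R∘(X∘D − n·id) + (ℓ+1)·id) ∘ (X∘D + (n+ℓ)·id) = X²∘H_{n,ℓ} + (n+ℓ)(n+ℓ+1)·id and (X∘D + (n+ℓ−2)·id) ∘ (R∘(X∘D − n·id) + (ℓ−1)·id) = X²∘H_{n,ℓ} + (n+ℓ−1)(n+ℓ−2)·id, where X² denotes multiplication by x². Consequently on ker H_{n,ℓ} the North narrow circuit acts as the scalar (n+ℓ)(n+ℓ+1) and the South narrow circuit acts as the scalar (n+ℓ−1)(n+ℓ−2). -/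
open Polynomial

theorem north_circuit_eq (n ℓ : ℝ) :
    (Rop * (Xop * Dop - n • 1) + (ℓ + 1) • 1) * (Xop * Dop + (n + ℓ) • 1)
      = Xop ^ 2 * Hleg n ℓ + ((n + ℓ) * (n + ℓ + 1)) • 1 := by
  refine LinearMap.ext fun p => ?_
  simp [Hleg, Rop, Xop, Dop, pow_two, smul_eq_C_mul]
  ring

theorem south_circuit_eq (n ℓ : ℝ) :
    (Xop * Dop + (n + ℓ - 2) • 1) * (Rop * (Xop * Dop - n • 1) + (ℓ - 1) • 1)
      = Xop ^ 2 * Hleg n ℓ + ((n + ℓ - 1) * (n + ℓ - 2)) • 1 := by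
  refine LinearMap.ext fun p => ?_
  have h2 : (C 2 : ℝ[X]) = 2 := rfl
  simp [Hleg, Rop, Xop, Dop, pow_two, smul_eq_C_mul, h2]
  ring

/-- The North and South narrow circuit identities of the Legendre–Gegenbauer grid and the
resulting scalar actions on `ker H_{n,ℓ}`. -/
theorem legendre_vertical_circuits (n ℓ : ℝ) :
    ((Rop * (Xop * Dop - n • 1) + (ℓ + 1) • 1) * (Xop * Dop + (n + ℓ) • 1)
        = Xop ^ 2 * Hleg n ℓ + ((n + ℓ) * (n + ℓ + 1)) • 1)
    ∧ ((Xop * Dop + (n + ℓ - 2) • 1) * (Rop * (Xop * Dop - n • 1) + (ℓ - 1) • 1)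
        = Xop ^ 2 * Hleg n ℓ + ((n + ℓ - 1) * (n + ℓ - 2)) • 1)
    ∧ (∀ p ∈ LinearMap.ker (Hleg n ℓ),
        ((Rop * (Xop * Dop - n • 1) + (ℓ + 1) • 1) * (Xop * Dop + (n + ℓ) • 1)) p
          = ((n + ℓ) * (n + ℓ + 1)) • p)
    ∧ (∀ p ∈ LinearMap.ker (Hleg n ℓ),
        ((Xop * Dop + (n + ℓ - 2) • 1) * (Rop * (Xop * Dop - n • 1) + (ℓ - 1) • 1)) p
          = ((n + ℓ - 1) * (n + ℓ - 2)) • p) := by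
  refine ⟨north_circuit_eq n ℓ, south_circuit_eq n ℓ, fun p hp => ?_, fun p hp => ?_⟩
  · rw [north_circuit_eq]
    simp [LinearMap.mem_ker.mp hp]
  · rw [south_circuit_eq]
    simp [LinearMap.mem_ker.mp hp]
end

section
/- For all real numbers n and ℓ the following identities of linear operators on ℝ[x] hold: D ∘ ((ℓ−1)·X + R∘D) = H_{n,ℓ} + (n+1)(n+ℓ−1)·id and ((ℓ+1)·X + R∘D) ∘ D = H_{n,ℓ} + n(n+ℓ)·id. Consequently on ker H_{n,ℓ} the Southeast narrow circuit D∘((ℓ−1)X + RD) acts as the scalar (n+1)(n+ℓ−1) and the Northwest narrow circuit ((ℓ+1)X + RD)∘D acts as the scalar n(n+ℓ). -/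
open Polynomial

/-- The Southeast and Northwest diagonal narrow circuit identities of the
Legendre–Gegenbauer grid and the resulting scalar actions on `ker H_{n,ℓ}`. -/
theorem legendre_diagonal_circuits (n ℓ : ℝ) :
    (Dop * ((ℓ - 1) • Xop + Rop * Dop) = Hleg n ℓ + ((n + 1) * (n + ℓ - 1)) • 1)
    ∧ (((ℓ + 1) • Xop + Rop * Dop) * Dop = Hleg n ℓ + (n * (n + ℓ)) • 1)
    ∧ (∀ p ∈ LinearMap.ker (Hleg n ℓ),
        (Dop * ((ℓ - 1) • Xop + Rop * Dop)) p = ((n + 1) * (n + ℓ - 1)) • p)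
    ∧ (∀ p ∈ LinearMap.ker (Hleg n ℓ),
        (((ℓ + 1) • Xop + Rop * Dop) * Dop) p = (n * (n + ℓ)) • p) := by
  have hSE : Dop * ((ℓ - 1) • Xop + Rop * Dop) =
      Hleg n ℓ + ((n + 1) * (n + ℓ - 1)) • 1 := by
    refine LinearMap.ext fun p => ?_
    simp only [Hleg, Rop, Dop, Xop, pow_two, Module.End.mul_apply, Module.End.one_apply,
      LinearMap.add_apply, LinearMap.sub_apply, LinearMap.smul_apply, LinearMap.mulLeft_apply,
      derivative_add, derivative_sub, derivative_mul, derivative_X, derivative_C, derivative_one,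
      smul_eq_C_mul, C_add, C_sub, C_mul, C_1]
    ring
  have hNW : ((ℓ + 1) • Xop + Rop * Dop) * Dop = Hleg n ℓ + (n * (n + ℓ)) • 1 := by
    rw [Hleg, sub_add_cancel, add_mul, smul_mul_assoc, mul_assoc, ← pow_two, add_comm]
  refine ⟨hSE, hNW, fun p hp => ?_, fun p hp => ?_⟩
  · rw [hSE, LinearMap.add_apply, LinearMap.mem_ker.mp hp, zero_add, LinearMap.smul_apply,
      Module.End.one_apply]
  · rw [hNW, LinearMap.add_apply, LinearMap.mem_ker.mp hp, zero_add, LinearMap.smul_apply,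
      Module.End.one_apply]
end

section
/- For every n ∈ ℕ the identity (R∘D + 2·X) ∘ (R∘D + 4·X) ∘ ⋯ ∘ (R∘D + 2n·X) = Dⁿ ∘ Rⁿ holds as linear operators on ℝ[x], where the composite on the left has the factor R∘D + 2j·X in the j-th position from the left (so R∘D + 2n·X is applied first) and Rⁿ denotes multiplication by (x² − 1)ⁿ. -/
open Polynomial

theorem commute_Rop_Xop : Commute Rop Xop :=
  ((Commute.refl Xop).mul_left (Commute.refl Xop)).sub_left (Commute.one_left Xop)

theorem Dop_mul_Xop : Dop * Xop = Xop * Dop + 1 := by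
  refine LinearMap.ext fun p => ?_
  simp [Dop, Xop, add_comm]

theorem Dop_mul_Rop : Dop * Rop = Rop * Dop + (2 : ℝ) • Xop := by
  have h : Dop * (Xop * Xop) = Xop * Xop * Dop + (2 : ℝ) • Xop := by
    rw [← mul_assoc, Dop_mul_Xop, add_mul, mul_assoc, Dop_mul_Xop, two_smul]
    noncomm_ring
  rw [Rop, mul_sub, h, sub_mul, mul_one, one_mul]
  abel

theorem Dop_mul_Rop_pow_succ (n : ℕ) :
    Dop * Rop ^ (n + 1) = Rop ^ n * (Rop * Dop + (2 * ((n : ℝ) + 1)) • Xop) := by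
  induction n with
  | zero => simp [Dop_mul_Rop]
  | succ n ih =>
    rw [pow_succ, ← mul_assoc, ih, mul_assoc, pow_succ Rop n, mul_assoc]
    congr 1
    rw [add_mul, mul_assoc, Dop_mul_Rop, smul_mul_assoc, ← commute_Rop_Xop.eq,
      mul_add Rop, mul_add Rop, mul_smul_comm, mul_smul_comm, add_assoc, ← add_smul]
    push_cast
    ring_nf

/-- `(R∘D + 2·X) ∘ (R∘D + 4·X) ∘ ⋯ ∘ (R∘D + 2n·X) = Dⁿ ∘ Rⁿ` as operators on `ℝ[x]`,
where the `j`-th factor from the left is `R∘D + 2j·X` (so `R∘D + 2n·X` is applied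
first). -/
theorem legendre_rodrigues_product (n : ℕ) :
    ((List.range n).map (fun j => Rop * Dop + (2 * ((j : ℝ) + 1)) • Xop)).prod
      = Dop ^ n * Rop ^ n := by
  induction n with
  | zero => simp
  | succ n ih =>
    simp only [List.pure_def, List.bind_eq_flatMap] at ih ⊢
    rw [List.range_succ, List.flatMap_append, List.map_append, List.prod_append, ih,
      List.flatMap_singleton, List.map_singleton, List.prod_singleton, mul_assoc, ← Dop_mul_Rop_pow_succ,
      ← mul_assoc, ← pow_succ]
end
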